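/- Let n₁, n₂ ≥ 1, let G₁ be a real n₁×n₁ matrix and G₂ a real n₂×n₂ matrix, let M₁, Q̄₁ be symmetric positive definite real n₁×n₁ matrices and M₂, Q̄₂ symmetric positive definite real n₂×n₂ matrices, and let δ > 0 satisfy G₁ᵀ M₁ G₁ − M₁ = Q̄₁ + (δ² + 2δ)·M₁ and G₂ᵀ M₂ G₂ − M₂ = −Q̄₂ + (δ² + 2δ)·M₂. For z₁ ∈ ℝ^{n₁}, z₂ ∈ ℝ^{n₂} write z := (z₁, z₂) and define V(z₁, z₂) := z₁ᵀ M₁ z₁ − z₂ᵀ M₂ z₂. Set c₀ := min(λ_min(Q̄₁), λ_min(Q̄₂)), c₁ := 2(‖M₁ G₁‖ + ‖M₂ G₂‖), and c₂ := λ_max(M₂). Then for every μ ≥ 0 and all w₁ ∈ ℝ^{n₁}, w₂ ∈ ℝ^{n₂} with ‖w₁‖ ≤ μ‖z‖ and ‖w₂‖ ≤ μ‖z‖, one has V(G₁ z₁ + w₁, G₂ z₂ + w₂) ≥ (1+δ)²·V(z₁, z₂) + (c₀ − c₁μ − c₂μ²)·‖z‖². -/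

import Mathlib

open Matrix

/-- The Euclidean norm of a real vector. -/
noncomputable def vnorm {n : ℕ} (v : Fin n → ℝ) : ℝ :=
  ‖(WithLp.equiv 2 (Fin n → ℝ)).symm v‖

/-- The induced (Euclidean) operator norm of a real matrix. -/
noncomputable def mnorm {m n : ℕ} (A : Matrix (Fin m) (Fin n) ℝ) : ℝ :=
  ‖LinearMap.toContinuousLinearMap (Matrix.toEuclideanLin A)‖

/-- The (ℓ²) product norm of a pair of real vectors. -/
noncomputable def pnorm {n p : ℕ} (v : Fin n → ℝ) (w : Fin p → ℝ) : ℝ :=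
  Real.sqrt (vnorm v ^ 2 + vnorm w ^ 2)

lemma vnorm_nonneg' {n : ℕ} (v : Fin n → ℝ) : 0 ≤ vnorm v := norm_nonneg _

lemma vnorm_eq {n : ℕ} (v : Fin n → ℝ) : vnorm v = ‖WithLp.toLp 2 v‖ := rfl

lemma dot_le_vnorm {n : ℕ} (v w : Fin n → ℝ) : |v ⬝ᵥ w| ≤ vnorm v * vnorm w := by
  have h := abs_real_inner_le_norm (WithLp.toLp 2 v) (WithLp.toLp 2 w)
  rw [EuclideanSpace.inner_toLp_toLp, star_trivial, dotProduct_comm] at h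
  exact h

lemma vnorm_mulVec_le {n : ℕ} (A : Matrix (Fin n) (Fin n) ℝ) (v : Fin n → ℝ) :
    vnorm (A.mulVec v) ≤ mnorm A * vnorm v :=
  (LinearMap.toContinuousLinearMap (Matrix.toEuclideanLin A)).le_opNorm (WithLp.toLp 2 v)

lemma quad_spectral {n : ℕ} {A : Matrix (Fin n) (Fin n) ℝ} (hA : A.IsHermitian)
    (x : Fin n → ℝ) : ∃ y : Fin n → ℝ, x ⬝ᵥ A.mulVec x = ∑ i, hA.eigenvalues i * y i ^ 2 ∧
      vnorm x ^ 2 = ∑ i, y i ^ 2 := by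
  have hsym : Aᵀ = A := by simpa using hA.eq
  refine ⟨fun i => (hA.eigenvectorBasis i).ofLp ⬝ᵥ x, ?_, ?_⟩
  · have h := hA.eigenvectorBasis.sum_inner_mul_inner (WithLp.toLp 2 x) (WithLp.toLp 2 (A.mulVec x))
    simp only [EuclideanSpace.inner_eq_star_dotProduct, star_trivial] at h
    rw [dotProduct_comm, ← h]
    refine Finset.sum_congr rfl fun i _ => ?_
    have h2 : A.mulVec x ⬝ᵥ (hA.eigenvectorBasis i).ofLp
        = hA.eigenvalues i * ((hA.eigenvectorBasis i).ofLp ⬝ᵥ x) := by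
      rw [dotProduct_comm, dotProduct_mulVec, ← mulVec_transpose, hsym,
        hA.mulVec_eigenvectorBasis, smul_dotProduct, smul_eq_mul]
    rw [h2]; ring
  · have h := hA.eigenvectorBasis.sum_inner_mul_inner (WithLp.toLp 2 x) (WithLp.toLp 2 x)
    rw [real_inner_self_eq_norm_sq] at h
    simp only [EuclideanSpace.inner_eq_star_dotProduct, star_trivial] at h
    rw [vnorm_eq, ← h]
    refine Finset.sum_congr rfl fun i _ => ?_
    rw [dotProduct_comm x]; ring

lemma quad_lower {n : ℕ} {A : Matrix (Fin n) (Fin n) ℝ} (hA : A.IsHermitian)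
    (x : Fin n → ℝ) : (⨅ i, hA.eigenvalues i) * vnorm x ^ 2 ≤ x ⬝ᵥ A.mulVec x := by
  obtain ⟨y, h1, h2⟩ := quad_spectral hA x
  rw [h1, h2, Finset.mul_sum]
  exact Finset.sum_le_sum fun i _ => mul_le_mul_of_nonneg_right
    (ciInf_le (Set.finite_range _).bddBelow i) (sq_nonneg _)

lemma quad_upper {n : ℕ} {A : Matrix (Fin n) (Fin n) ℝ} (hA : A.IsHermitian)
    (x : Fin n → ℝ) : x ⬝ᵥ A.mulVec x ≤ (⨆ i, hA.eigenvalues i) * vnorm x ^ 2 := by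
  obtain ⟨y, h1, h2⟩ := quad_spectral hA x
  rw [h1, h2, Finset.mul_sum]
  exact Finset.sum_le_sum fun i _ => mul_le_mul_of_nonneg_right
    (le_ciSup (Set.finite_range _).bddAbove i) (sq_nonneg _)

lemma quad_expand {n : ℕ} {M : Matrix (Fin n) (Fin n) ℝ} (hM : M.IsHermitian)
    (G : Matrix (Fin n) (Fin n) ℝ) (z w : Fin n → ℝ) :
    (G.mulVec z + w) ⬝ᵥ M.mulVec (G.mulVec z + w) =
      z ⬝ᵥ (Gᵀ * M * G).mulVec z + 2 * (w ⬝ᵥ (M * G).mulVec z) + w ⬝ᵥ M.mulVec w := by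
  have hsym : Mᵀ = M := by simpa using hM.eq
  have e1 : z ⬝ᵥ (Gᵀ * M * G).mulVec z = G.mulVec z ⬝ᵥ M.mulVec (G.mulVec z) := by
    rw [← mulVec_mulVec, ← mulVec_mulVec, dotProduct_mulVec, vecMul_transpose]
  have e2 : G.mulVec z ⬝ᵥ M.mulVec w = w ⬝ᵥ M.mulVec (G.mulVec z) := by
    rw [dotProduct_mulVec, ← mulVec_transpose, hsym, dotProduct_comm]
  rw [e1, ← mulVec_mulVec, mulVec_add, add_dotProduct, dotProduct_add, dotProduct_add, e2]
  ring

lemma cross_le {n : ℕ} (A : Matrix (Fin n) (Fin n) ℝ) (z w : Fin n → ℝ) (μ p : ℝ)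
    (hμ : 0 ≤ μ) (hp : 0 ≤ p) (hz : vnorm z ≤ p) (hw : vnorm w ≤ μ * p) :
    |w ⬝ᵥ A.mulVec z| ≤ mnorm A * μ * p ^ 2 := by
  have hA : 0 ≤ mnorm A := norm_nonneg _
  calc |w ⬝ᵥ A.mulVec z| ≤ vnorm w * vnorm (A.mulVec z) := dot_le_vnorm _ _
    _ ≤ (μ * p) * (mnorm A * p) := by
      apply mul_le_mul hw _ (vnorm_nonneg' _) (by positivity)
      exact (vnorm_mulVec_le A z).trans (mul_le_mul_of_nonneg_left hz hA)
    _ = _ := by ring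

/-- One-step growth estimate for the indefinite Lyapunov function
`V(z₁,z₂) = z₁ᵀM₁z₁ − z₂ᵀM₂z₂` along the perturbed block dynamics. -/
theorem lyapunov_one_step_growth {n₁ n₂ : ℕ} (hn₁ : 1 ≤ n₁) (hn₂ : 1 ≤ n₂)
    (G₁ : Matrix (Fin n₁) (Fin n₁) ℝ) (G₂ : Matrix (Fin n₂) (Fin n₂) ℝ)
    (M₁ Q₁ : Matrix (Fin n₁) (Fin n₁) ℝ) (M₂ Q₂ : Matrix (Fin n₂) (Fin n₂) ℝ)
    (hM₁ : M₁.PosDef) (hQ₁ : Q₁.PosDef) (hM₂ : M₂.PosDef) (hQ₂ : Q₂.PosDef)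
    (δ : ℝ) (hδ : 0 < δ)
    (hG₁ : G₁ᵀ * M₁ * G₁ - M₁ = Q₁ + (δ ^ 2 + 2 * δ) • M₁)
    (hG₂ : G₂ᵀ * M₂ * G₂ - M₂ = -Q₂ + (δ ^ 2 + 2 * δ) • M₂)
    (V : (Fin n₁ → ℝ) → (Fin n₂ → ℝ) → ℝ)
    (hV : ∀ z₁ z₂, V z₁ z₂ = z₁ ⬝ᵥ M₁.mulVec z₁ - z₂ ⬝ᵥ M₂.mulVec z₂)
    (c₀ c₁ c₂ : ℝ)
    (hc₀ : c₀ = min (⨅ i, hQ₁.1.eigenvalues i) (⨅ i, hQ₂.1.eigenvalues i))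
    (hc₁ : c₁ = 2 * (mnorm (M₁ * G₁) + mnorm (M₂ * G₂)))
    (hc₂ : c₂ = ⨆ i, hM₂.1.eigenvalues i) :
    ∀ (μ : ℝ), 0 ≤ μ →
      ∀ (z₁ : Fin n₁ → ℝ) (z₂ : Fin n₂ → ℝ) (w₁ : Fin n₁ → ℝ) (w₂ : Fin n₂ → ℝ),
        vnorm w₁ ≤ μ * pnorm z₁ z₂ → vnorm w₂ ≤ μ * pnorm z₁ z₂ →
        (1 + δ) ^ 2 * V z₁ z₂ + (c₀ - c₁ * μ - c₂ * μ ^ 2) * pnorm z₁ z₂ ^ 2 ≤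
          V (G₁.mulVec z₁ + w₁) (G₂.mulVec z₂ + w₂) := by
  intro μ hμ z₁ z₂ w₁ w₂ h1 h2
  have hp : 0 ≤ pnorm z₁ z₂ := Real.sqrt_nonneg _
  have hp2 : pnorm z₁ z₂ ^ 2 = vnorm z₁ ^ 2 + vnorm z₂ ^ 2 := Real.sq_sqrt (by positivity)
  have hz1 : vnorm z₁ ≤ pnorm z₁ z₂ := Real.le_sqrt_of_sq_le (by nlinarith [sq_nonneg (vnorm z₂)])
  have hz2 : vnorm z₂ ≤ pnorm z₁ z₂ := Real.le_sqrt_of_sq_le (by nlinarith [sq_nonneg (vnorm z₁)])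
  have k1 := (abs_le.1 (cross_le (M₁ * G₁) z₁ w₁ μ _ hμ hp hz1 h1)).1
  have k2 := (abs_le.1 (cross_le (M₂ * G₂) z₂ w₂ μ _ hμ hp hz2 h2)).2
  have q1 := quad_lower hQ₁.1 z₁
  have q2 := quad_lower hQ₂.1 z₂
  have m1 : 0 ≤ w₁ ⬝ᵥ M₁.mulVec w₁ := by
    simpa using hM₁.posSemidef.dotProduct_mulVec_nonneg w₁
  have hc2 : 0 ≤ c₂ := by
    rw [hc₂]; exact Real.iSup_nonneg fun i => (hM₂.eigenvalues_pos i).le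
  have m2 : w₂ ⬝ᵥ M₂.mulVec w₂ ≤ c₂ * (μ ^ 2 * pnorm z₁ z₂ ^ 2) := by
    refine (quad_upper hM₂.1 w₂).trans ?_
    rw [← hc₂, ← mul_pow]
    exact mul_le_mul_of_nonneg_left (pow_le_pow_left₀ (vnorm_nonneg' _) h2 2) hc2
  have r1 : c₀ * vnorm z₁ ^ 2 ≤ z₁ ⬝ᵥ Q₁.mulVec z₁ :=
    (mul_le_mul_of_nonneg_right (hc₀ ▸ min_le_left _ _) (sq_nonneg _)).trans q1
  have r2 : c₀ * vnorm z₂ ^ 2 ≤ z₂ ⬝ᵥ Q₂.mulVec z₂ :=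
    (mul_le_mul_of_nonneg_right (hc₀ ▸ min_le_right _ _) (sq_nonneg _)).trans q2
  have g1 := congrArg (fun A => z₁ ⬝ᵥ A.mulVec z₁) hG₁
  have g2 := congrArg (fun A => z₂ ⬝ᵥ A.mulVec z₂) hG₂
  simp only [sub_mulVec, add_mulVec, neg_mulVec, smul_mulVec, dotProduct_sub, dotProduct_add,
    dotProduct_neg, dotProduct_smul, smul_eq_mul] at g1 g2
  rw [hV, hV, quad_expand hM₁.1, quad_expand hM₂.1, hc₁]
  have hc0 : c₀ * pnorm z₁ z₂ ^ 2 = c₀ * vnorm z₁ ^ 2 + c₀ * vnorm z₂ ^ 2 := by rw [hp2]; ring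
  linarith
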